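/- arXiv:2107.03295 — 2 statements merged into one kernel-verified Lean document; each statement's English description precedes it below -/
import Mathlib

section
/- (Estimates for SO₀(2,1)-coefficients; Lemma 3.5(1)) For every κ ∈ (0,1] and every C > 0 there is a constant C′ = C′(κ, C) > 0 with the following property: whenever R₀ ≥ 1, L ≥ 1, and a, b, d ∈ ℝ satisfy |−b s² + (a − d) s| ≤ C · max{R₀, s^{1−κ}} for all s ∈ [0, L], then |b| ≤ C′ · R₀ · L^{−1−κ} and |a − d| ≤ C′ · R₀ · L^{−κ}. -/
/-- A quadratic `p s ^ 2 + q s` bounded by `M` at `L` and `L / 2` has coefficients controlled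
by `M`. -/
theorem abs_quadratic_coeff_le {p q L M : ℝ} (hL : 0 ≤ L)
    (h₁ : |p * L ^ 2 + q * L| ≤ M) (h₂ : |p * (L / 2) ^ 2 + q * (L / 2)| ≤ M) :
    |p| * L ^ 2 ≤ 6 * M ∧ |q| * L ≤ 5 * M := by
  rw [abs_le] at h₁ h₂
  constructor
  · rw [← abs_of_nonneg (sq_nonneg L), ← abs_mul, abs_le]
    constructor <;> linarith
  · nth_rewrite 1 [← abs_of_nonneg hL]
    rw [← abs_mul, abs_le]
    constructor <;> linarith

/-- **Estimates for `SO₀(2,1)`-coefficients (Lemma 3.5(1)).**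
For every `κ ∈ (0,1]` and `C > 0` there is `C' = C'(κ, C) > 0` such that whenever
`R₀ ≥ 1`, `L ≥ 1` and `a, b, d ∈ ℝ` satisfy
`|−b s² + (a − d) s| ≤ C * max R₀ (s^(1−κ))` for all `s ∈ [0, L]`, then
`|b| ≤ C' * R₀ * L^(−1−κ)` and `|a − d| ≤ C' * R₀ * L^(−κ)`. -/
theorem so21_coefficient_estimates
    (κ : ℝ) (hκ : κ ∈ Set.Ioc (0:ℝ) 1) (C : ℝ) (hC : 0 < C) :
    ∃ C' : ℝ, 0 < C' ∧
      ∀ (R₀ L : ℝ), 1 ≤ R₀ → 1 ≤ L →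
      ∀ a b d : ℝ,
        (∀ s ∈ Set.Icc (0:ℝ) L,
          |-b * s ^ 2 + (a - d) * s| ≤ C * max R₀ (s ^ (1 - κ))) →
        |b| ≤ C' * R₀ * L ^ (-1 - κ) ∧ |a - d| ≤ C' * R₀ * L ^ (-κ) := by
  obtain ⟨-, hκ1⟩ := hκ
  refine ⟨6 * C, by positivity, fun R₀ L hR hL a b d h ↦ ?_⟩
  have hL0 : 0 < L := by linarith
  have bound : ∀ s ∈ Set.Icc (0:ℝ) L,
      |-b * s ^ 2 + (a - d) * s| ≤ C * (R₀ * L ^ (1 - κ)) := fun s hs ↦ by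
    refine (h s hs).trans (mul_le_mul_of_nonneg_left (max_le ?_ ?_) hC.le)
    · exact le_mul_of_one_le_right (by linarith) (Real.one_le_rpow hL (by linarith))
    · exact (Real.rpow_le_rpow hs.1 hs.2 (by linarith)).trans
        (le_mul_of_one_le_left (by positivity) hR)
  obtain ⟨hb, had⟩ := abs_quadratic_coeff_le hL0.le (bound L ⟨hL0.le, le_rfl⟩)
    (bound (L / 2) ⟨by positivity, by linarith⟩)
  rw [abs_neg] at hb
  have e₁ : L ^ (1 - κ) = L ^ (-1 - κ) * L ^ 2 := by
    rw [← Real.rpow_natCast L 2, ← Real.rpow_add hL0]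
    congr 1
    push_cast
    ring
  have e₂ : L ^ (1 - κ) = L ^ (-κ) * L := by
    rw [← Real.rpow_add_one hL0.ne']
    congr 1
    ring
  constructor
  · refine le_of_mul_le_mul_right (hb.trans_eq ?_) (pow_pos hL0 2)
    rw [e₁]
    ring
  · refine le_of_mul_le_mul_right (had.trans ?_) hL0
    have hM : 0 ≤ C * (R₀ * (L ^ (-κ) * L)) := by positivity
    rw [e₂]
    linarith
end

section
/- (Joining dichotomy from a commuting ergodic transformation; Lemma 3.1) Let (X, μ) and (Y, ν) be standard Borel probability spaces, let T₁ : X → X and S : Y → Y be measurable measure-preserving maps, and let ρ be a probability measure on X × Y whose marginal on X is μ and whose marginal on Y is ν, and which is invariant and ergodic for the product map T₁ × S. Let T : X → X be a measurable μ-measure-preserving map that is ergodic with respect to μ and commutes with T₁ (T ∘ T₁ = T₁ ∘ T). Then either the push-forward measure (T × id_Y)_*ρ and ρ are mutually singular, or ρ = μ × ν (the product measure). -/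
open MeasureTheory

/-- Two probability measures that are ergodic for the same map are mutually singular or equal. -/
theorem Ergodic.mutuallySingular_or_eq {α : Type*} [MeasurableSpace α] {f : α → α}
    {μ ν : Measure α} [IsProbabilityMeasure μ] [IsProbabilityMeasure ν]
    (hμ : Ergodic f μ) (hν : Ergodic f ν) : μ ⟂ₘ ν ∨ μ = ν := by
  have hdec := μ.singularPart_add_rnDeriv ν
  obtain ⟨c, hc⟩ := hν.eq_smul_of_absolutelyContinuous
    (hμ.toMeasurePreserving.withDensity_rnDeriv hν.toMeasurePreserving)
    (withDensity_absolutelyContinuous _ _)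
  rw [hc] at hdec
  rcases eq_or_ne c 0 with rfl | hc0
  · left
    rw [← hdec, zero_smul, add_zero]
    exact μ.mutuallySingular_singularPart ν
  · right
    refine (hμ.eq_of_absolutelyContinuous hν.toMeasurePreserving ?_).symm
    refine (Measure.absolutelyContinuous_smul hc0).trans (Measure.absolutelyContinuous_of_le ?_)
    exact (Measure.le_add_left le_rfl).trans_eq hdec

/-- A probability measure on a product that is preserved by `T × id`, where `T` is ergodic for
its first marginal, is the product of its marginals. -/
theorem MeasureTheory.MeasurePreserving.eq_prod_of_ergodic_fst {X Y : Type*} [MeasurableSpace X]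
    [MeasurableSpace Y] {ρ : Measure (X × Y)} [IsProbabilityMeasure ρ] {T : X → X}
    (hρ : MeasurePreserving (Prod.map T id) ρ ρ) (hT : Ergodic T ρ.fst) :
    ρ = ρ.fst.prod ρ.snd := by
  refine (Measure.prod_eq fun A B hA hB => ?_).symm
  have hB' : MeasurableSet (Prod.snd ⁻¹' B : Set (X × Y)) := measurable_snd hB
  have hinv : MeasurePreserving T (ρ.restrict (Prod.snd ⁻¹' B)).fst
      (ρ.restrict (Prod.snd ⁻¹' B)).fst :=
    (measurable_fst.measurePreserving _).of_semiconj (hρ.restrict_preimage hB')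
      (fun _ => rfl) hT.measurable
  obtain ⟨c, hc⟩ := hT.eq_smul_of_absolutelyContinuous hinv
    (Measure.absolutelyContinuous_of_le (Measure.map_mono Measure.restrict_le_self measurable_fst))
  have key : ∀ s, MeasurableSet s → ρ (s ×ˢ B) = c * ρ.fst s := fun s hs => by
    have h := congrArg (fun m : Measure X => m s) hc
    simpa [Measure.fst_apply hs, Measure.restrict_apply (measurable_fst hs),
      ← Set.prod_eq] using h
  have hc' : ρ.snd B = c := by
    have h := key Set.univ .univ
    rwa [Set.univ_prod, ← Measure.snd_apply hB, measure_univ, mul_one] at h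
  rw [key A hA, hc', mul_comm]

/-- **Joining dichotomy from a commuting ergodic transformation (Lemma 3.1).**
Let `(X, μ)` and `(Y, ν)` be standard Borel probability spaces, `T₁ : X → X` and
`S : Y → Y` measure-preserving, and `ρ` a probability measure on `X × Y` with
marginals `μ` and `ν` which is invariant and ergodic for `T₁ × S`. If `T : X → X`
is a measure-preserving map which is ergodic for `μ` and commutes with `T₁`, then
either `(T × id)_* ρ` and `ρ` are mutually singular, or `ρ = μ × ν`. -/
theorem joining_dichotomy_commuting_ergodic
    {X Y : Type*} [MeasurableSpace X] [StandardBorelSpace X]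
    [MeasurableSpace Y] [StandardBorelSpace Y]
    (μ : Measure X) (ν : Measure Y)
    [IsProbabilityMeasure μ] [IsProbabilityMeasure ν]
    (T₁ : X → X) (S : Y → Y)
    (hT₁ : MeasurePreserving T₁ μ μ) (hS : MeasurePreserving S ν ν)
    (ρ : Measure (X × Y)) [IsProbabilityMeasure ρ]
    (hfst : ρ.map Prod.fst = μ) (hsnd : ρ.map Prod.snd = ν)
    (herg : Ergodic (Prod.map T₁ S) ρ)
    (T : X → X) (hT : Ergodic T μ) (hcomm : T ∘ T₁ = T₁ ∘ T) :
    Measure.MutuallySingular (ρ.map (Prod.map T id)) ρ ∨ ρ = μ.prod ν := by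
  have hTm : Measurable (Prod.map T (id : Y → Y)) := hT.measurable.prodMap measurable_id
  have hTρ : MeasurePreserving (Prod.map T id) ρ (ρ.map (Prod.map T id)) :=
    hTm.measurePreserving ρ
  have : IsProbabilityMeasure (ρ.map (Prod.map T id)) :=
    Measure.isProbabilityMeasure_map hTm.aemeasurable
  have hσ : Ergodic (Prod.map T₁ S) (ρ.map (Prod.map T id)) :=
    hTρ.ergodic_of_ergodic_semiconj herg herg.measurable
      fun p => Prod.ext (congrFun hcomm p.1) rfl
  refine (hσ.mutuallySingular_or_eq herg).imp_right fun h => ?_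
  subst hfst hsnd
  exact MeasurePreserving.eq_prod_of_ergodic_fst ⟨hTm, h⟩ hT
end
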